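/- arXiv:2409.13531 — 4 statements merged into one kernel-verified Lean document; each statement's English description precedes it below -/
import Mathlib

section
/- If V is a random variable with the exponential distribution of rate 1, then E[-log V] equals the Euler–Mascheroni constant γ; equivalently, ∫₀^∞ (-log v)·e^{-v} dv = γ. Consequently, the standard Gumbel distribution has mean γ. -/
open MeasureTheory

theorem integral_neg_log_mul_exp_neg :
    (∫ v in Set.Ioi (0 : ℝ), (-Real.log v) * Real.exp (-v)) = Real.eulerMascheroniConstant := by
  have h_deriv : HasDerivAt Complex.GammaIntegral (-(Real.eulerMascheroniConstant : ℂ)) 1 := by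
    refine Complex.hasDerivAt_Gamma_one.congr_of_eventuallyEq ?_
    filter_upwards [(isOpen_lt continuous_const Complex.continuous_re).mem_nhds
      (show (0 : ℝ) < (1 : ℂ).re by simp)] with s hs
    exact (Complex.Gamma_eq_integral hs).symm
  have h := (Complex.hasDerivAt_GammaIntegral (s := 1) (by simp)).unique h_deriv
  simp only [sub_self, Complex.cpow_zero, one_mul, ← Complex.ofReal_mul, ← Complex.ofReal_neg,
    integral_complex_ofReal, Complex.ofReal_inj] at h
  simp only [neg_mul, integral_neg, h, neg_neg]

theorem integral_neg_log_expMeasure_one :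
    (∫ x, -Real.log x ∂ProbabilityTheory.expMeasure 1) = Real.eulerMascheroniConstant := by
  rw [← integral_neg_log_mul_exp_neg, ProbabilityTheory.expMeasure,
    ProbabilityTheory.gammaMeasure,
    integral_withDensity_eq_integral_toReal_smul
      (show Measurable (ProbabilityTheory.gammaPDF 1 1) from
        (ProbabilityTheory.measurable_gammaPDFReal 1 1).ennreal_ofReal)
      (ae_of_all _ fun x ↦ ENNReal.ofReal_lt_top)]
  change ∫ x, (ProbabilityTheory.exponentialPDF 1 x).toReal • -Real.log x = _
  rw [← setIntegral_eq_integral_of_forall_compl_eq_zero (s := Set.Ioi (0 : ℝ))]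
  · refine setIntegral_congr_fun measurableSet_Ioi fun x hx ↦ ?_
    simp only [ProbabilityTheory.exponentialPDF_of_nonneg (le_of_lt hx), one_mul, smul_eq_mul,
      ENNReal.toReal_ofReal (Real.exp_pos _).le]
    exact mul_comm _ _
  · intro x hx
    rcases (Set.notMem_Ioi.mp hx).eq_or_lt with rfl | hx
    · simp
    · simp [ProbabilityTheory.exponentialPDF_of_neg hx]

theorem map_eq_expMeasure_one_of_tail {Ω : Type*} [MeasurableSpace Ω] (P : Measure Ω)
    [IsProbabilityMeasure P] (V : Ω → ℝ) (hV : Measurable V)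
    (hexp : ∀ t : ℝ, 0 ≤ t → P {ω | t < V ω} = ENNReal.ofReal (Real.exp (-t))) :
    P.map V = ProbabilityTheory.expMeasure 1 := by
  have := ProbabilityTheory.isProbabilityMeasure_expMeasure one_pos
  have := Measure.isProbabilityMeasure_map (μ := P) hV.aemeasurable
  have h_cdf (t : ℝ) (ht : 0 ≤ t) : (P.map V).real (Set.Iic t) = 1 - Real.exp (-t) := by
    rw [← Set.compl_Ioi, probReal_compl_eq_one_sub measurableSet_Ioi,
      map_measureReal_apply hV measurableSet_Ioi, measureReal_def]
    change 1 - (P {ω | t < V ω}).toReal = _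
    rw [hexp t ht, ENNReal.toReal_ofReal (Real.exp_pos _).le]
  refine Measure.eq_of_cdf _ _ (StieltjesFunction.ext fun t ↦ ?_)
  rw [ProbabilityTheory.cdf_expMeasure_eq one_pos, ProbabilityTheory.cdf_eq_real]
  split_ifs with ht
  · rw [h_cdf t ht, one_mul]
  · refine le_antisymm ?_ measureReal_nonneg
    calc (P.map V).real (Set.Iic t)
        ≤ (P.map V).real (Set.Iic 0) :=
          measureReal_mono (Set.Iic_subset_Iic.mpr (not_le.mp ht).le)
      _ = 0 := by simp [h_cdf 0 le_rfl]

/-- If `V` is exponentially distributed with rate 1, then `E[-log V]` equals the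
Euler–Mascheroni constant `γ`; equivalently `∫₀^∞ (-log v)·e^{-v} dv = γ`.
(Since `-log V` is standard Gumbel, the standard Gumbel distribution has mean `γ`.) -/
theorem stmt_1
    {Ω : Type*} [MeasurableSpace Ω] (P : Measure Ω) [IsProbabilityMeasure P]
    (V : Ω → ℝ) (hV : Measurable V)
    (hexp : ∀ t : ℝ, 0 ≤ t → P {ω | t < V ω} = ENNReal.ofReal (Real.exp (-t))) :
    (∫ ω, -Real.log (V ω) ∂P) = Real.eulerMascheroniConstant ∧
      (∫ v in Set.Ioi (0 : ℝ), (-Real.log v) * Real.exp (-v))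
        = Real.eulerMascheroniConstant := by
  refine ⟨?_, integral_neg_log_mul_exp_neg⟩
  rw [← integral_neg_log_expMeasure_one, ← map_eq_expMeasure_one_of_tail P V hV hexp]
  exact (integral_map hV.aemeasurable Real.measurable_log.neg.aestronglyMeasurable).symm
end

section
/- If V is a random variable with the exponential distribution of rate 1, then the variance of -log V equals π²/6; equivalently, ∫₀^∞ (log v)²·e^{-v} dv = γ² + π²/6, where γ is the Euler–Mascheroni constant. Consequently, the standard Gumbel distribution has variance π²/6. -/
open MeasureTheory

open Set Filter Topology Asymptotics in
/-- The Mellin transform of `t ↦ log t ^ n * exp (-t)` converges on the right half plane, where its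
derivative is the Mellin transform of `t ↦ log t ^ (n + 1) * exp (-t)`. -/
lemma mellinConvergent_and_hasDerivAt_log_pow_mul_exp_neg (n : ℕ) {s : ℂ} (hs : 0 < s.re) :
    MellinConvergent (fun t => ((Real.log t ^ n * Real.exp (-t) : ℝ) : ℂ)) s ∧
      HasDerivAt (mellin fun t => ((Real.log t ^ n * Real.exp (-t) : ℝ) : ℂ))
        (mellin (fun t => ((Real.log t ^ (n + 1) * Real.exp (-t) : ℝ) : ℂ)) s) s := by
  have hsucc (k : ℕ) : (fun t : ℝ => ((Real.log t ^ (k + 1) * Real.exp (-t) : ℝ) : ℂ)) =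
      fun t => Real.log t • ((Real.log t ^ k * Real.exp (-t) : ℝ) : ℂ) := by
    funext t
    rw [Complex.real_smul, pow_succ']
    push_cast
    ring
  have htop (k : ℕ) : ∀ a : ℝ, (fun t : ℝ => ((Real.log t ^ k * Real.exp (-t) : ℝ) : ℂ))
      =O[atTop] (fun t : ℝ => t ^ (-a)) := by
    induction k with
    | zero =>
      intro a
      rw [← isBigO_norm_left]
      simp_rw [Complex.norm_real, isBigO_norm_left]
      simpa using (isLittleO_exp_neg_mul_rpow_atTop zero_lt_one (-a)).isBigO
    | succ k ih =>
      intro a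
      rw [hsucc]
      exact isBigO_rpow_top_log_smul (lt_add_one a) (ih (a + 1))
  have hbot (k : ℕ) : ∀ b : ℝ, 0 < b →
      (fun t : ℝ => ((Real.log t ^ k * Real.exp (-t) : ℝ) : ℂ))
        =O[𝓝[>] 0] (fun t : ℝ => t ^ (-b)) := by
    induction k with
    | zero =>
      intro b hb
      have hone : (fun t : ℝ => ((Real.log t ^ 0 * Real.exp (-t) : ℝ) : ℂ))
          =O[𝓝[>] 0] (fun _ : ℝ => (1 : ℝ)) := by
        have hc : Continuous fun t : ℝ => ((Real.log t ^ 0 * Real.exp (-t) : ℝ) : ℂ) := by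
          simp only [pow_zero]
          fun_prop
        exact (hc.continuousWithinAt (s := Ioi 0) (x := 0)).isBigO_one ℝ
      refine hone.trans (IsBigO.of_bound 1 ?_)
      filter_upwards [Ioo_mem_nhdsGT (zero_lt_one (α := ℝ))] with t ht
      rw [norm_one, one_mul, Real.norm_of_nonneg (Real.rpow_nonneg ht.1.le _)]
      exact Real.one_le_rpow_of_pos_of_le_one_of_nonpos ht.1 ht.2.le (by linarith)
    | succ k ih =>
      intro b hb
      rw [hsucc]
      exact isBigO_rpow_zero_log_smul (half_lt_self hb) (ih (b / 2) (half_pos hb))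
  have hloc (k : ℕ) : LocallyIntegrableOn
      (fun t : ℝ => ((Real.log t ^ k * Real.exp (-t) : ℝ) : ℂ)) (Ioi 0) := by
    refine ContinuousOn.locallyIntegrableOn ?_ measurableSet_Ioi
    refine Complex.continuous_ofReal.comp_continuousOn (ContinuousOn.mul ?_ (by fun_prop))
    exact (Real.continuousOn_log.mono fun t ht => (ne_of_gt ht : t ≠ 0)).pow k
  refine ⟨mellinConvergent_of_isBigO_rpow (hloc n) (htop n _) (lt_add_one _)
    (hbot n _ (half_pos hs)) (half_lt_self hs), ?_⟩
  rw [hsucc]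
  exact (mellin_hasDerivAt_of_isBigO_rpow (hloc n) (htop n _) (lt_add_one _)
    (hbot n _ (half_pos hs)) (half_lt_self hs)).2

lemma integrableOn_log_pow_mul_exp_neg (n : ℕ) :
    IntegrableOn (fun t => Real.log t ^ n * Real.exp (-t)) (Set.Ioi 0) := by
  have h := (mellinConvergent_and_hasDerivAt_log_pow_mul_exp_neg n (s := 1) (by simp)).1
  simp only [MellinConvergent, sub_self, Complex.cpow_zero, one_smul] at h
  exact h.re

lemma mellin_log_pow_mul_exp_neg_one (n : ℕ) :
    mellin (fun t => ((Real.log t ^ n * Real.exp (-t) : ℝ) : ℂ)) 1 =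
      ((∫ t in Set.Ioi (0 : ℝ), Real.log t ^ n * Real.exp (-t) : ℝ) : ℂ) := by
  simp only [mellin, sub_self, Complex.cpow_zero, one_smul]
  exact integral_ofReal

lemma mellin_log_pow_zero_mul_exp_neg {s : ℂ} (hs : 0 < s.re) :
    mellin (fun t => ((Real.log t ^ 0 * Real.exp (-t) : ℝ) : ℂ)) s = Complex.Gamma s := by
  simp [Complex.Gamma_eq_integral hs, Complex.GammaIntegral_eq_mellin]

lemma integral_log_mul_exp_neg :
    ∫ t in Set.Ioi (0 : ℝ), Real.log t * Real.exp (-t) = -Real.eulerMascheroniConstant := by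
  have h := (mellinConvergent_and_hasDerivAt_log_pow_mul_exp_neg 0 (s := 1) (by simp)).2
  rw [zero_add, mellin_log_pow_mul_exp_neg_one] at h
  have heq : Complex.Gamma =ᶠ[nhds 1]
      mellin fun t => ((Real.log t ^ 0 * Real.exp (-t) : ℝ) : ℂ) := by
    filter_upwards [Complex.continuous_re.continuousAt.eventually_mem
      (Ioi_mem_nhds (show (0 : ℝ) < (1 : ℂ).re by simp))] with s hs
    exact (mellin_log_pow_zero_mul_exp_neg hs).symm
  have := (h.congr_of_eventuallyEq heq).unique Complex.hasDerivAt_Gamma_one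
  simpa using (by exact_mod_cast this :
    ∫ t in Set.Ioi (0 : ℝ), Real.log t ^ 1 * Real.exp (-t) = -Real.eulerMascheroniConstant)

/-- If `M 0, M 1, M 2, …` are successive derivatives near `1` and `M 0` satisfies Euler's reflection
formula in the form `M 0 (1 + z) * M 0 (1 - z) * sin (π z) = π z`, then the second derivative at `1`
is determined by the first one. -/
lemma second_deriv_of_reflection {M : ℕ → ℂ → ℂ}
    (hM : ∀ n s, 0 < s.re → HasDerivAt (M n) (M (n + 1) s) s) (hone : M 0 1 = 1)
    (hrefl : ∀ z ∈ Metric.ball (0 : ℂ) 1,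
      M 0 (1 + z) * M 0 (1 - z) * Complex.sin (Real.pi * z) = Real.pi * z) :
    M 2 1 = M 1 1 ^ 2 + Real.pi ^ 2 / 6 := by
  set π : ℂ := (Real.pi : ℂ)
  have hπ : π ≠ 0 := by simp [π]
  have hplus (n : ℕ) {z : ℂ} (hz : z ∈ Metric.ball (0 : ℂ) 1) :
      HasDerivAt (fun w => M n (1 + w)) (M (n + 1) (1 + z)) z := by
    have hre := (abs_lt.1 ((Complex.abs_re_le_norm z).trans_lt (by simpa using hz))).1
    simpa using (hM n (1 + z) (by simp; linarith)).comp_const_add 1 z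
  have hminus (n : ℕ) {z : ℂ} (hz : z ∈ Metric.ball (0 : ℂ) 1) :
      HasDerivAt (fun w => M n (1 - w)) (-M (n + 1) (1 - z)) z := by
    have hre := (abs_lt.1 ((Complex.abs_re_le_norm z).trans_lt (by simpa using hz))).2
    simpa using (hM n (1 - z) (by simp; linarith)).comp_const_sub 1 z
  have hsin (z : ℂ) : HasDerivAt (fun w => Complex.sin (π * w)) (π * Complex.cos (π * z)) z := by
    simpa [mul_comm] using ((hasDerivAt_id z).const_mul π).csin
  have hcos (z : ℂ) :
      HasDerivAt (fun w => Complex.cos (π * w)) (-(π * Complex.sin (π * z))) z := by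
    simpa [mul_comm] using ((hasDerivAt_id z).const_mul π).ccos
  have deriv_unique {f g : ℂ → ℂ} {f' g' z : ℂ} (hz : z ∈ Metric.ball (0 : ℂ) 1)
      (hfg : ∀ w ∈ Metric.ball (0 : ℂ) 1, f w = g w) (hf : HasDerivAt f f' z)
      (hg : HasDerivAt g g' z) : f' = g' :=
    hf.unique (hg.congr_of_eventuallyEq
      (Filter.eventuallyEq_of_mem (Metric.isOpen_ball.mem_nhds hz) hfg))
  have first (z : ℂ) (hz : z ∈ Metric.ball (0 : ℂ) 1) :=
    deriv_unique hz hrefl (((hplus 0 hz).mul (hminus 0 hz)).mul (hsin z))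
      ((hasDerivAt_id z).const_mul π)
  simp only [Pi.mul_apply, zero_add] at first
  have second (z : ℂ) (hz : z ∈ Metric.ball (0 : ℂ) 1) :=
    deriv_unique hz first
      (((((hplus 1 hz).mul (hminus 0 hz)).add ((hplus 0 hz).mul (hminus 1 hz).neg)).mul
        (hsin z)).add (((hplus 0 hz).mul (hminus 0 hz)).mul ((hcos z).const_mul π)))
      (hasDerivAt_const z (π * 1))
  simp only [Pi.mul_apply, Pi.add_apply, Pi.neg_apply, zero_add, one_add_one_eq_two] at second
  have h0 : (0 : ℂ) ∈ Metric.ball (0 : ℂ) 1 := by simp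
  have third := deriv_unique h0 second
    ((((((((hplus 2 h0).mul (hminus 0 h0)).add ((hplus 1 h0).mul (hminus 1 h0).neg)).add
        (((hplus 1 h0).mul (hminus 1 h0).neg).add
          ((hplus 0 h0).mul (hminus 2 h0).neg.neg))).mul (hsin 0)).add
      ((((hplus 1 h0).mul (hminus 0 h0)).add ((hplus 0 h0).mul (hminus 1 h0).neg)).mul
        ((hcos 0).const_mul π))).add
      (((((hplus 1 h0).mul (hminus 0 h0)).add ((hplus 0 h0).mul (hminus 1 h0).neg)).mul
        ((hcos 0).const_mul π)).add
        (((hplus 0 h0).mul (hminus 0 h0)).mul (((hsin 0).const_mul π).neg.const_mul π)))))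
    (hasDerivAt_const (0 : ℂ) (0 : ℂ))
  simp [hone] at third
  apply mul_left_cancel₀ (mul_ne_zero (by norm_num : (6 : ℂ) ≠ 0) hπ)
  linear_combination third

theorem integral_log_sq_mul_exp_neg :
    ∫ t in Set.Ioi (0 : ℝ), Real.log t ^ 2 * Real.exp (-t) =
      Real.eulerMascheroniConstant ^ 2 + Real.pi ^ 2 / 6 := by
  have h := second_deriv_of_reflection
    (M := fun n => mellin fun t => ((Real.log t ^ n * Real.exp (-t) : ℝ) : ℂ))
    (fun n s hs => (mellinConvergent_and_hasDerivAt_log_pow_mul_exp_neg n hs).2)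
    (by rw [mellin_log_pow_zero_mul_exp_neg (by simp), Complex.Gamma_one]) ?_
  · simp only [mellin_log_pow_mul_exp_neg_one] at h
    simp only [pow_one, integral_log_mul_exp_neg] at h
    rw [← neg_sq Real.eulerMascheroniConstant]
    exact_mod_cast h
  · intro z hz
    have hre := abs_lt.1 ((Complex.abs_re_le_norm z).trans_lt (by simpa using hz))
    rw [mellin_log_pow_zero_mul_exp_neg (by simp; linarith),
      mellin_log_pow_zero_mul_exp_neg (by simp; linarith)]
    rcases eq_or_ne z 0 with rfl | hz0
    · simp
    rw [add_comm, Complex.Gamma_add_one z hz0, mul_assoc z, Complex.Gamma_mul_Gamma_one_sub]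
    have hsin : Complex.sin (Real.pi * z) ≠ 0 := by
      rw [Complex.sin_ne_zero_iff]
      rintro k hk
      rw [mul_comm] at hk
      have hzk : z = k := mul_right_cancel₀ (by simp) hk
      rw [hzk, Complex.intCast_re] at hre
      have h1 : -1 < k := by exact_mod_cast hre.1
      have h2 : k < 1 := by exact_mod_cast hre.2
      exact hz0 (by rw [hzk, show k = 0 by omega, Int.cast_zero])
    rw [mul_assoc, div_mul_cancel₀ _ hsin, mul_comm]

open ProbabilityTheory in
lemma map_eq_expMeasure_one {Ω : Type*} [MeasurableSpace Ω] (P : Measure Ω)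
    [IsProbabilityMeasure P] {V : Ω → ℝ} (hV : Measurable V)
    (hexp : ∀ t : ℝ, 0 ≤ t → P {ω | t < V ω} = ENNReal.ofReal (Real.exp (-t))) :
    P.map V = expMeasure 1 := by
  have := Measure.isProbabilityMeasure_map (μ := P) hV.aemeasurable
  have := isProbabilityMeasure_expMeasure one_pos
  refine Measure.eq_of_cdf _ _ (StieltjesFunction.ext fun x => ?_)
  have hcdf (t : ℝ) : cdf (P.map V) t = 1 - P.real {ω | t < V ω} := by
    rw [cdf_eq_real, map_measureReal_apply hV measurableSet_Iic,
      ← probReal_compl_eq_one_sub (measurableSet_lt measurable_const hV)]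
    congr 1
    ext ω
    simp
  have hpos (t : ℝ) (ht : 0 ≤ t) : cdf (P.map V) t = 1 - Real.exp (-t) := by
    rw [hcdf, measureReal_def, hexp t ht, ENNReal.toReal_ofReal (Real.exp_pos _).le]
  rw [cdf_expMeasure_eq one_pos]
  split_ifs with hx
  · rw [hpos x hx, one_mul]
  · refine le_antisymm ?_ (cdf_nonneg _ _)
    simpa [hpos 0 le_rfl] using monotone_cdf (P.map V) (not_le.1 hx).le

open ProbabilityTheory in
lemma expMeasure_one_eq_withDensity :
    expMeasure 1 = (volume.restrict (Set.Ioi 0)).withDensity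
      fun t => ENNReal.ofReal (Real.exp (-t)) := by
  rw [restrict_Ioi_eq_restrict_Ici, ← withDensity_indicator measurableSet_Ici]
  change volume.withDensity (exponentialPDF 1) = _
  congr 1
  ext t
  by_cases ht : 0 ≤ t <;> simp [exponentialPDF_eq, ht]

open ProbabilityTheory in
lemma integral_expMeasure_one (f : ℝ → ℝ) :
    ∫ t, f t ∂expMeasure 1 = ∫ t in Set.Ioi (0 : ℝ), f t * Real.exp (-t) := by
  rw [expMeasure_one_eq_withDensity, integral_withDensity_eq_integral_toReal_smul (by fun_prop)
    (by simp)]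
  simp [ENNReal.toReal_ofReal (Real.exp_pos _).le, mul_comm]

open ProbabilityTheory in
lemma integrable_expMeasure_one_iff (f : ℝ → ℝ) :
    Integrable f (expMeasure 1) ↔ IntegrableOn (fun t => f t * Real.exp (-t)) (Set.Ioi 0) := by
  rw [expMeasure_one_eq_withDensity, integrable_withDensity_iff (by fun_prop) (by simp)]
  simp [ENNReal.toReal_ofReal (Real.exp_pos _).le, IntegrableOn]

open ProbabilityTheory in
theorem variance_log_expMeasure_one : variance Real.log (expMeasure 1) = Real.pi ^ 2 / 6 := by
  have := isProbabilityMeasure_expMeasure one_pos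
  have hL2 : MemLp Real.log 2 (expMeasure 1) := by
    rw [memLp_two_iff_integrable_sq Real.measurable_log.aestronglyMeasurable,
      integrable_expMeasure_one_iff]
    exact integrableOn_log_pow_mul_exp_neg 2
  rw [variance_eq_sub hL2, integral_expMeasure_one, integral_expMeasure_one]
  simp only [Pi.pow_apply, integral_log_sq_mul_exp_neg, integral_log_mul_exp_neg]
  ring

/-- If `V` is exponentially distributed with rate 1, then the variance of `-log V` equals
`π²/6`; equivalently `∫₀^∞ (log v)²·e^{-v} dv = γ² + π²/6`.
(Since `-log V` is standard Gumbel, the standard Gumbel distribution has variance `π²/6`.) -/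
theorem stmt_2
    {Ω : Type*} [MeasurableSpace Ω] (P : Measure Ω) [IsProbabilityMeasure P]
    (V : Ω → ℝ) (hV : Measurable V)
    (hexp : ∀ t : ℝ, 0 ≤ t → P {ω | t < V ω} = ENNReal.ofReal (Real.exp (-t))) :
    ProbabilityTheory.variance (fun ω => -Real.log (V ω)) P = Real.pi ^ 2 / 6 ∧
      (∫ v in Set.Ioi (0 : ℝ), (Real.log v) ^ 2 * Real.exp (-v))
        = Real.eulerMascheroniConstant ^ 2 + Real.pi ^ 2 / 6 := by
  refine ⟨?_, integral_log_sq_mul_exp_neg⟩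
  rw [ProbabilityTheory.variance_fun_neg, ← variance_log_expMeasure_one,
    ← map_eq_expMeasure_one P hV hexp,
    ProbabilityTheory.variance_map Real.measurable_log.aemeasurable hV.aemeasurable]
  rfl
end

section
/- Let α > 0 and w > 0, and let Y be a random variable with the Pareto distribution with tail index α and threshold w. Then E[-log(log(Y/w))] = log α + γ, where γ is the Euler–Mascheroni constant. In particular, if α = exp(⟨x, β⟩) for a covariate vector x ∈ ℝ^K and parameter vector β ∈ ℝ^K, then the transformed variable z = -log(log(Y/w)) - γ satisfies E[z] = ⟨x, β⟩. -/
open MeasureTheory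

/-- The integral representation of the derivative of the Gamma function at `1`. -/
lemma integral_exp_neg_mul_log_Ioi :
    ∫ t in Set.Ioi (0 : ℝ), Real.exp (-t) * Real.log t = -Real.eulerMascheroniConstant := by
  have h1 := Complex.hasDerivAt_GammaIntegral (s := 1) (by simp)
  have h2 : Complex.GammaIntegral =ᶠ[nhds 1] Complex.Gamma := by
    have hopen : IsOpen {s : ℂ | 0 < s.re} := isOpen_lt continuous_const Complex.continuous_re
    filter_upwards [hopen.mem_nhds (show (1 : ℂ) ∈ {s : ℂ | 0 < s.re} by simp)] with s hs
    exact (Complex.Gamma_eq_integral hs).symm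
  have h3 := (h1.congr_of_eventuallyEq h2.symm).unique Complex.hasDerivAt_Gamma_one
  simp only [sub_self, Complex.cpow_zero, one_mul] at h3
  have h4 : ((∫ t in Set.Ioi (0 : ℝ), Real.exp (-t) * Real.log t : ℝ) : ℂ)
      = ((-Real.eulerMascheroniConstant : ℝ) : ℂ) := by
    rw [← integral_complex_ofReal]
    push_cast at h3 ⊢
    rw [← h3]
    simp only [mul_comm]
  exact_mod_cast h4

lemma integral_log_expMeasure_one :
    ∫ t, Real.log t ∂(ProbabilityTheory.expMeasure 1) = -Real.eulerMascheroniConstant := by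
  have hpdf : ProbabilityTheory.expMeasure 1
      = volume.withDensity (ProbabilityTheory.exponentialPDF 1) := rfl
  have hmeas : Measurable (ProbabilityTheory.exponentialPDF 1) :=
    (ProbabilityTheory.measurable_exponentialPDFReal 1).ennreal_ofReal
  rw [hpdf, integral_withDensity_eq_integral_toReal_smul hmeas
    (by simp [ProbabilityTheory.exponentialPDF]), ← integral_exp_neg_mul_log_Ioi,
    ← integral_Ici_eq_integral_Ioi, ← integral_indicator measurableSet_Ici]
  congr 1
  ext t
  by_cases ht : 0 ≤ t
  · simp [ProbabilityTheory.exponentialPDF_of_nonneg ht, ht, Real.exp_nonneg]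
  · simp [ProbabilityTheory.exponentialPDF_of_neg (not_le.1 ht), ht]

lemma integrable_log_expMeasure_one :
    Integrable Real.log (ProbabilityTheory.expMeasure 1) := by
  by_contra h
  have h1 := integral_undef h
  rw [integral_log_expMeasure_one] at h1
  linarith [Real.one_half_lt_eulerMascheroniConstant]

/-- If `Y` is Pareto with tail index `α` and threshold `w`, then `α log (Y / w)` is standard
exponential. -/
lemma map_mul_log_div_eq_expMeasure
    {Ω : Type*} [MeasurableSpace Ω] (P : Measure Ω) [IsProbabilityMeasure P]
    {α w : ℝ} (hα : 0 < α) (hw : 0 < w) {Y : Ω → ℝ} (hY : Measurable Y)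
    (hcdf : ∀ y : ℝ, w ≤ y → P {ω | Y ω ≤ y} = ENNReal.ofReal (1 - (y / w) ^ (-α)))
    (hpos : ∀ᵐ ω ∂P, w < Y ω) :
    P.map (fun ω => α * Real.log (Y ω / w)) = ProbabilityTheory.expMeasure 1 := by
  have hE : Measurable (fun ω => α * Real.log (Y ω / w)) := by fun_prop
  have := ProbabilityTheory.isProbabilityMeasure_expMeasure one_pos
  have := Measure.isProbabilityMeasure_map (μ := P) hE.aemeasurable
  refine Measure.ext_of_Iic _ _ fun t => ?_
  rw [← ProbabilityTheory.ofReal_cdf (ProbabilityTheory.expMeasure 1),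
    ProbabilityTheory.cdf_expMeasure_eq one_pos, Measure.map_apply hE measurableSet_Iic]
  split_ifs with ht
  · have hexp : (w * Real.exp (t / α)) / w = Real.exp (t / α) := by field_simp
    have hle : w ≤ w * Real.exp (t / α) :=
      le_mul_of_one_le_right hw.le (Real.one_le_exp (by positivity))
    have hset : P ((fun ω => α * Real.log (Y ω / w)) ⁻¹' Set.Iic t)
        = P {ω | Y ω ≤ w * Real.exp (t / α)} := by
      refine measure_congr ?_
      filter_upwards [hpos] with ω hω
      have hdiv : 0 < Y ω / w := div_pos (hw.trans hω) hw
      refine propext ?_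
      change α * Real.log (Y ω / w) ≤ t ↔ Y ω ≤ w * Real.exp (t / α)
      rw [← le_div_iff₀' hα, Real.log_le_iff_le_exp hdiv, div_le_iff₀' hw]
    rw [hset, hcdf _ hle, hexp, ← Real.exp_mul]
    congr 4
    field_simp
  · rw [ENNReal.ofReal_zero, measure_eq_zero_iff_ae_notMem]
    filter_upwards [hpos] with ω hω hmem
    have hlog : 0 < Real.log (Y ω / w) := Real.log_pos ((one_lt_div hw).2 hω)
    have hmem' : α * Real.log (Y ω / w) ≤ t := hmem
    exact ht ((mul_pos hα hlog).le.trans hmem')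

/-- If `Y` is Pareto with tail index `α > 0` and threshold `w > 0`, then
`E[-log(log(Y/w))] = log α + γ` with `γ` the Euler–Mascheroni constant. In particular,
if `α = exp(⟨x, β⟩)` for vectors `x, β ∈ ℝ^K`, then `z = -log(log(Y/w)) - γ` satisfies
`E[z] = ⟨x, β⟩`. -/
theorem stmt_7
    {Ω : Type*} [MeasurableSpace Ω] (P : Measure Ω) [IsProbabilityMeasure P]
    (α w : ℝ) (hα : 0 < α) (hw : 0 < w)
    (Y : Ω → ℝ) (hY : Measurable Y)
    (hcdf : ∀ y : ℝ, w ≤ y → P {ω | Y ω ≤ y} = ENNReal.ofReal (1 - (y / w) ^ (-α)))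
    (hcdf0 : ∀ y : ℝ, y < w → P {ω | Y ω ≤ y} = 0) :
    (∫ ω, -Real.log (Real.log (Y ω / w)) ∂P)
        = Real.log α + Real.eulerMascheroniConstant ∧
      ∀ (K : ℕ) (x β : Fin K → ℝ), α = Real.exp (∑ i, x i * β i) →
        (∫ ω, (-Real.log (Real.log (Y ω / w)) - Real.eulerMascheroniConstant) ∂P)
          = ∑ i, x i * β i := by
  have hpos : ∀ᵐ ω ∂P, w < Y ω := by
    have h := hcdf w le_rfl
    rw [div_self hw.ne', Real.one_rpow, sub_self, ENNReal.ofReal_zero] at h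
    simpa [ae_iff] using h
  have hE : Measurable (fun ω => α * Real.log (Y ω / w)) := by fun_prop
  have hmap := map_mul_log_div_eq_expMeasure P hα hw hY hcdf hpos
  have hint : Integrable (fun ω => Real.log (α * Real.log (Y ω / w))) P := by
    have h := integrable_log_expMeasure_one
    rw [← hmap] at h
    exact h.comp_measurable hE
  have hval : ∫ ω, Real.log (α * Real.log (Y ω / w)) ∂P = -Real.eulerMascheroniConstant := by
    rw [← integral_log_expMeasure_one, ← hmap,
      integral_map hE.aemeasurable Real.measurable_log.aestronglyMeasurable]
  have hae : (fun ω => -Real.log (Real.log (Y ω / w)))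
      =ᵐ[P] fun ω => Real.log α - Real.log (α * Real.log (Y ω / w)) := by
    filter_upwards [hpos] with ω hω
    have hlog : 0 < Real.log (Y ω / w) := Real.log_pos ((one_lt_div hw).2 hω)
    rw [Real.log_mul hα.ne' hlog.ne']
    ring
  have hmean : (∫ ω, -Real.log (Real.log (Y ω / w)) ∂P)
      = Real.log α + Real.eulerMascheroniConstant := by
    rw [integral_congr_ae hae, integral_sub (integrable_const _) hint, hval]
    simp
  have hint' : Integrable (fun ω => -Real.log (Real.log (Y ω / w))) P :=
    ((integrable_const _).sub hint).congr hae.symm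
  refine ⟨hmean, fun K x β hαβ => ?_⟩
  rw [integral_sub hint' (integrable_const _), hmean, hαβ, Real.log_exp]
  simp
end

section
/- Let X : Ω → ℝ^K be a random vector whose first coordinate equals 1 almost surely, with A = E[X Xᵀ] finite and invertible. Let m₁ ≠ 0 and m₂ be real numbers, set s = 1 - 2m₁ + 2m₂, and define the matrices Σ = s·A - (1 - m₁)²·E[X]·E[X]ᵀ and H = -m₁·A. Then H⁻¹ Σ H⁻¹ = (s/m₁²)·A⁻¹ - ((1 - m₁)²/m₁²)·e₁ e₁ᵀ, where e₁ is the first standard basis vector of ℝ^K. In other words, the sandwich asymptotic variance of the misspecified MLE equals E[X Xᵀ]⁻¹·M - B, with M = (1 - 2m₁ + 2m₂)/m₁² and B affecting only the intercept entry. -/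
open MeasureTheory Matrix

/-- Conjugating `c A - d (A v)(v A)` by the inverse of `-m A` cancels `A` in the rank-one term. -/
theorem inv_neg_smul_sandwich {n 𝕜 : Type*} [Fintype n] [DecidableEq n] [Field 𝕜]
    {A : Matrix n n 𝕜} (hA : IsUnit A.det) {m : 𝕜} (hm : m ≠ 0) (c d : 𝕜) (v : n → 𝕜) :
    ((-m) • A)⁻¹ * (c • A - d • vecMulVec (A *ᵥ v) (v ᵥ* A)) * ((-m) • A)⁻¹
      = (c / m ^ 2) • A⁻¹ - (d / m ^ 2) • vecMulVec v v := by
  have hinv : ((-m) • A)⁻¹ = (-m)⁻¹ • A⁻¹ := by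
    refine Matrix.inv_eq_left_inv ?_
    rw [smul_mul_smul_comm, Matrix.nonsing_inv_mul _ hA, inv_mul_cancel₀ (neg_ne_zero.2 hm),
      one_smul]
  have hvv : A⁻¹ * vecMulVec (A *ᵥ v) (v ᵥ* A) * A⁻¹ = vecMulVec v v := by
    rw [Matrix.mul_vecMulVec, Matrix.vecMulVec_mul, Matrix.mulVec_mulVec, Matrix.vecMul_vecMul,
      Matrix.nonsing_inv_mul _ hA, Matrix.mul_nonsing_inv _ hA, Matrix.one_mulVec,
      Matrix.vecMul_one]
  have hc : (-m)⁻¹ * (c * (-m)⁻¹) = c / m ^ 2 := by field_simp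
  have hd : (-m)⁻¹ * (d * (-m)⁻¹) = d / m ^ 2 := by field_simp
  rw [hinv]
  simp only [Matrix.smul_mul, Matrix.mul_smul, Matrix.mul_sub, Matrix.sub_mul, hvv, smul_sub,
    Matrix.nonsing_inv_mul _ hA, Matrix.one_mul, smul_smul, hc, hd]

/-- Sandwich form of the asymptotic variance of the misspecified MLE. If `X : Ω → ℝ^K`
has first coordinate `1` a.s. with `A = E[X Xᵀ]` finite and invertible, `m₁ ≠ 0`,
`s = 1 - 2m₁ + 2m₂`, `Σ = s·A - (1-m₁)²·E[X]E[X]ᵀ` and `H = -m₁·A`, then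
`H⁻¹ Σ H⁻¹ = (s/m₁²)·A⁻¹ - ((1-m₁)²/m₁²)·e₁e₁ᵀ`. -/
theorem stmt_14
    {Ω : Type*} [MeasurableSpace Ω] (P : Measure Ω) [IsProbabilityMeasure P]
    {K : ℕ} [NeZero K] (X : Ω → Fin K → ℝ) (hX : Measurable X)
    (hone : ∀ᵐ ω ∂P, X ω 0 = 1)
    (hint : ∀ i j, Integrable (fun ω => X ω i * X ω j) P)
    (A : Matrix (Fin K) (Fin K) ℝ)
    (hA : A = Matrix.of fun i j => ∫ ω, X ω i * X ω j ∂P)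
    (hdet : IsUnit A.det)
    (m₁ m₂ s : ℝ) (hm₁ : m₁ ≠ 0) (hs : s = 1 - 2 * m₁ + 2 * m₂)
    (EX : Fin K → ℝ) (hEX : EX = fun i => ∫ ω, X ω i ∂P)
    (S H : Matrix (Fin K) (Fin K) ℝ)
    (hS : S = s • A - (1 - m₁) ^ 2 • Matrix.vecMulVec EX EX)
    (hH : H = (-m₁) • A) :
    H⁻¹ * S * H⁻¹
      = (s / m₁ ^ 2) • A⁻¹
        - ((1 - m₁) ^ 2 / m₁ ^ 2)
            • Matrix.vecMulVec (Pi.single (0 : Fin K) 1) (Pi.single (0 : Fin K) 1) := by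
  have hcol : A *ᵥ Pi.single 0 1 = EX := by
    ext i
    rw [Matrix.mulVec_single_one, hA, hEX]
    refine integral_congr_ae ?_
    filter_upwards [hone] with ω hω
    simp [hω]
  have hrow : Pi.single 0 1 ᵥ* A = EX := by
    have hsymm : Aᵀ = A := by
      ext i j
      simp [hA, mul_comm]
    rw [← hcol, ← Matrix.mulVec_transpose, hsymm]
  have h := inv_neg_smul_sandwich hdet hm₁ s ((1 - m₁) ^ 2) (Pi.single 0 1)
  rwa [hcol, hrow, ← hS, ← hH] at h
end
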